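/- arXiv:1807.06469 — 2 statements merged into one kernel-verified Lean document; each statement's English description precedes it below -/
import Mathlib

section
/- Let p > 1 be a rational number and n̂ a positive integer. Let s* and s be binary strings of length 4·n̂ such that (i) s* has exactly n̂ ones, all occurring among the first 3·n̂ positions, and (ii) s has exactly 3 ones among its first 3·n̂ positions and its last n̂ positions form the string 0 ∘ 1^(n̂−1). If the number of positions ℓ with s*[ℓ] = s[ℓ] = 1 is not exactly one, then hd(s*, s)^p + hd(s*, s̄)^p > 2·(2·n̂)^p, where s̄ denotes the bitwise complement of s. -/
theorem hammingDist_add_two_mul_card_inter {ι : Type*} [Fintype ι] (x y : ι → Bool) :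
    hammingDist x y + 2 * (Finset.univ.filter fun i => x i = true ∧ y i = true).card
      = (Finset.univ.filter fun i => x i = true).card
        + (Finset.univ.filter fun i => y i = true).card := by
  simp only [hammingDist, Finset.card_filter, Finset.mul_sum, ← Finset.sum_add_distrib]
  refine Finset.sum_congr rfl fun i _ => ?_
  cases x i <;> cases y i <;> rfl

theorem hammingDist_add_hammingDist_not {ι : Type*} [Fintype ι] (x y : ι → Bool) :
    hammingDist x y + hammingDist x (fun i => !y i) = Fintype.card ι := by
  rw [← Finset.card_univ, Finset.card_eq_sum_ones]
  simp only [hammingDist, Finset.card_filter, ← Finset.sum_add_distrib]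
  refine Finset.sum_congr rfl fun i _ => ?_
  cases x i <;> cases y i <;> rfl

theorem two_mul_rpow_lt_rpow_add_rpow {p a b m : ℝ} (hp : 1 < p) (ha : 0 ≤ a) (hb : 0 ≤ b)
    (hab : a ≠ b) (hm : a + b = 2 * m) : 2 * m ^ p < a ^ p + b ^ p := by
  have h := (strictConvexOn_rpow hp).2 ha hb hab
    (one_half_pos (α := ℝ)) one_half_pos (add_halves 1)
  simp only [smul_eq_mul] at h
  rw [show 1 / 2 * a + 1 / 2 * b = m by linarith] at h
  linarith


theorem stmt_6 (p : ℚ) (hp : 1 < p) (nh : ℕ) (hnh : 0 < nh)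
    (sstar s : Fin (4 * nh) → Bool)
    (h1 : (Finset.univ.filter fun i : Fin (4 * nh) => sstar i = true).card = nh)
    (h2 : ∀ i : Fin (4 * nh), sstar i = true → (i : ℕ) < 3 * nh)
    (h3 : (Finset.univ.filter fun i : Fin (4 * nh) => s i = true ∧ (i : ℕ) < 3 * nh).card = 3)
    (h4 : ∀ i : Fin (4 * nh), 3 * nh ≤ (i : ℕ) → s i = decide ((i : ℕ) ≠ 3 * nh))
    (hcov : (Finset.univ.filter fun ℓ : Fin (4 * nh) => sstar ℓ = true ∧ s ℓ = true).card ≠ 1) :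
    2 * (2 * (nh : ℝ)) ^ (p : ℝ)
      < (hammingDist sstar s : ℝ) ^ (p : ℝ)
        + (hammingDist sstar (fun i => !s i) : ℝ) ^ (p : ℝ) := by
  have hgt : (Finset.univ.filter fun i : Fin (4 * nh) =>
      s i = true ∧ ¬ (i : ℕ) < 3 * nh).card = nh - 1 := by
    have : (Finset.univ.filter fun i : Fin (4 * nh) => s i = true ∧ ¬ (i : ℕ) < 3 * nh)
        = Finset.Ioi ⟨3 * nh, by omega⟩ := by
      ext i
      simp only [Finset.mem_filter, Finset.mem_univ, true_and, Finset.mem_Ioi, Fin.lt_def]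
      constructor
      · rintro ⟨hs, hi⟩
        rw [h4 i (by omega), decide_eq_true_eq] at hs
        omega
      · intro hi
        exact ⟨by rw [h4 i hi.le, decide_eq_true_eq]; omega, by omega⟩
    rw [this, Fin.card_Ioi]
    simp only
    omega
  have hs : (Finset.univ.filter fun i : Fin (4 * nh) => s i = true).card = 3 + (nh - 1) := by
    rw [← Finset.card_filter_add_card_filter_not (fun i : Fin (4 * nh) => (i : ℕ) < 3 * nh),
      Finset.filter_filter, Finset.filter_filter, h3, hgt]
  have hdist := hammingDist_add_two_mul_card_inter sstar s
  have hsum := hammingDist_add_hammingDist_not sstar s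
  rw [Fintype.card_fin] at hsum
  refine two_mul_rpow_lt_rpow_add_rpow (by exact_mod_cast hp) (Nat.cast_nonneg _)
    (Nat.cast_nonneg _) (fun h => ?_) ?_
  · have h' := Nat.cast_injective h
    omega
  · have : (hammingDist sstar s : ℝ) + hammingDist sstar (fun i => !s i) = 4 * nh := by
      exact_mod_cast hsum
    linarith
end

section
/- Let p = a/b > 1 where a and b are coprime positive integers with a > b. Let G be a simple graph with vertices v_1, …, v_n and edges e_1, …, e_m, let n̂ = n + m and N = (2^b+2)·n̂, and let S be the following family of binary strings of length N. Group 1: one copy of 1^((2^b+1)·n̂) ∘ 0^(n̂) and 2^(a−b) copies of 0^N. Group 2: for each vertex v_i (1 ≤ i ≤ n), the string s_i = u_i ∘ 0^((2^b−2)·n̂) ∘ 0 ∘ 1^(n̂−1) and the string r_i = ū_i ∘ 0^((2^b−2)·n̂) ∘ 1 ∘ 0^(n̂−1), where u_i is the length-3·n̂ string with ones exactly in positions 3i−2, 3i−1, 3i and ū_i is its bitwise complement. Group 3: for each edge e_j = {v_i, v_{i'}} (1 ≤ j ≤ m) and each z ∈ {0,1,2}, the string t_j^(z) = e_j^(z)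 ∘ 0^((2^b−2)·n̂) ∘ 0 ∘ 1^(n̂−1) and the string w_j^(z) = ē_j^(z) ∘ 0^((2^b−2)·n̂) ∘ 1 ∘ 0^(n̂−1), where e_j^(z) is the length-3·n̂ string with ones exactly in positions 3i−2+z, 3i'−2+z, and 3(n+j)−2+z, and ē_j^(z) is its bitwise complement. Then G admits a proper 3-coloring of its vertices if and only if there exists a binary string s* of length N such that the sum over all strings s of S (counted with multiplicity) of hd(s*, s)^p is at most (2^a + 2^(a−b))·n̂^p + 2·(n + 3m)·(2·n̂)^p. -/
/-- The group-1 string `1^((2^b+1)·nh) ∘ 0^(nh)`. -/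
def grpOne (b nh : ℕ) : Fin ((2 ^ b + 2) * nh) → Bool :=
  fun j => decide ((j : ℕ) < (2 ^ b + 1) * nh)

/-- The vertex string `s_i = u_i ∘ 0^((2^b−2)·nh) ∘ 0 ∘ 1^(nh−1)`
(here `i` is the 0-indexed vertex index, so `u_i` has its ones at
positions `3i, 3i+1, 3i+2`). -/
def vStr (b nh i : ℕ) : Fin ((2 ^ b + 2) * nh) → Bool :=
  fun j =>
    if (j : ℕ) < 3 * nh then decide (3 * i ≤ (j : ℕ) ∧ (j : ℕ) < 3 * i + 3)
    else if (j : ℕ) < (2 ^ b + 1) * nh then false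
    else if (j : ℕ) = (2 ^ b + 1) * nh then false
    else true

/-- The vertex string `r_i = ū_i ∘ 0^((2^b−2)·nh) ∘ 1 ∘ 0^(nh−1)`. -/
def vStrC (b nh i : ℕ) : Fin ((2 ^ b + 2) * nh) → Bool :=
  fun j =>
    if (j : ℕ) < 3 * nh then !decide (3 * i ≤ (j : ℕ) ∧ (j : ℕ) < 3 * i + 3)
    else if (j : ℕ) < (2 ^ b + 1) * nh then false
    else if (j : ℕ) = (2 ^ b + 1) * nh then true
    else false

/-- The edge string `t_j^(z) = e_j^(z) ∘ 0^((2^b−2)·nh) ∘ 0 ∘ 1^(nh−1)` for the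
edge `e_j = {v_i, v_{i'}}` (all of `i, i', j` 0-indexed), where `e_j^(z)` has its
ones exactly at positions `3i+z`, `3i'+z` and `3(n+j)+z`. -/
def eStr (b nh n i i' j z : ℕ) : Fin ((2 ^ b + 2) * nh) → Bool :=
  fun q =>
    if (q : ℕ) < 3 * nh then
      decide ((q : ℕ) = 3 * i + z ∨ (q : ℕ) = 3 * i' + z ∨ (q : ℕ) = 3 * (n + j) + z)
    else if (q : ℕ) < (2 ^ b + 1) * nh then false
    else if (q : ℕ) = (2 ^ b + 1) * nh then false
    else true

/-- The edge string `w_j^(z) = ē_j^(z) ∘ 0^((2^b−2)·nh) ∘ 1 ∘ 0^(nh−1)`. -/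
def eStrC (b nh n i i' j z : ℕ) : Fin ((2 ^ b + 2) * nh) → Bool :=
  fun q =>
    if (q : ℕ) < 3 * nh then
      !decide ((q : ℕ) = 3 * i + z ∨ (q : ℕ) = 3 * i' + z ∨ (q : ℕ) = 3 * (n + j) + z)
    else if (q : ℕ) < (2 ^ b + 1) * nh then false
    else if (q : ℕ) = (2 ^ b + 1) * nh then true
    else false

open Finset

section Convexity

variable {p : ℝ}

theorem rpow_tangent_lt (hp : 1 < p) {c x : ℝ} (hc : 0 < c) (hx : 0 ≤ x) (hxc : x ≠ c) :
    c ^ p + p * c ^ (p - 1) * (x - c) < x ^ p := by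
  have hs : -1 ≤ x / c - 1 := by linarith [div_nonneg hx hc.le]
  have hs' : x / c - 1 ≠ 0 := by
    rw [sub_ne_zero, Ne, div_eq_one_iff_eq hc.ne']
    exact hxc
  have h := one_add_mul_self_lt_rpow_one_add hs hs' hp
  rw [add_sub_cancel, Real.div_rpow hx hc.le, lt_div_iff₀ (Real.rpow_pos_of_pos hc p)] at h
  have hcp : c ^ p = c ^ (p - 1) * c := by
    rw [Real.rpow_sub_one hc.ne', div_mul_cancel₀ _ hc.ne']
  have hxc' : x / c * c = x := div_mul_cancel₀ x hc.ne'
  refine lt_of_eq_of_lt ?_ h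
  rw [hcp]
  linear_combination (-p * c ^ (p - 1)) * hxc'

theorem rpow_tangent_le (hp : 1 < p) {c x : ℝ} (hc : 0 < c) (hx : 0 ≤ x) :
    c ^ p + p * c ^ (p - 1) * (x - c) ≤ x ^ p := by
  rcases eq_or_ne x c with rfl | hxc
  · simp
  · exact (rpow_tangent_lt hp hc hx hxc).le

theorem rpow_add_mul_rpow_ge (hp : 1 < p) {w c d u v : ℝ} (hw : 0 < w) (hc : 0 < c) (hd : 0 < d)
    (hcd : c ^ (p - 1) = w * d ^ (p - 1)) (hu : 0 ≤ u) (hv : 0 ≤ v) (huv : c + d ≤ u + v) :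
    c ^ p + w * d ^ p ≤ u ^ p + w * v ^ p := by
  have h1 := rpow_tangent_le hp hc hu
  have h2 := mul_le_mul_of_nonneg_left (rpow_tangent_le hp hd hv) hw.le
  have h3 : 0 ≤ p * c ^ (p - 1) * (u + v - (c + d)) :=
    mul_nonneg (mul_nonneg (by linarith) (Real.rpow_nonneg hc.le _)) (by linarith)
  rw [hcd] at h1 h3
  nlinarith

theorem eq_and_eq_of_rpow_add_mul_rpow_le (hp : 1 < p) {w c d u v : ℝ} (hw : 0 < w) (hc : 0 < c)
    (hd : 0 < d) (hcd : c ^ (p - 1) = w * d ^ (p - 1)) (hu : 0 ≤ u) (hv : 0 ≤ v)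
    (huv : c + d ≤ u + v) (h : u ^ p + w * v ^ p ≤ c ^ p + w * d ^ p) : u = c ∧ v = d := by
  have h1 := rpow_tangent_le hp hc hu
  have h2 := mul_le_mul_of_nonneg_left (rpow_tangent_le hp hd hv) hw.le
  have h3 : 0 ≤ p * c ^ (p - 1) * (u + v - (c + d)) :=
    mul_nonneg (mul_nonneg (by linarith) (Real.rpow_nonneg hc.le _)) (by linarith)
  by_contra hne
  rw [not_and_or] at hne
  rcases hne with hne | hne
  · have h1' := rpow_tangent_lt hp hc hu hne
    rw [hcd] at h1' h3
    nlinarith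
  · have h2' := mul_lt_mul_of_pos_left (rpow_tangent_lt hp hd hv hne) hw
    rw [hcd] at h1 h3
    nlinarith

end Convexity

/-- The binary string of length `N` whose ones are at the positions in `A`. -/
def indStr (N : ℕ) (A : Finset ℕ) : Fin N → Bool := fun q => decide ((q : ℕ) ∈ A)

theorem exists_eq_indStr {N : ℕ} (s : Fin N → Bool) : ∃ A ⊆ range N, s = indStr N A := by
  refine ⟨(univ.filter fun q => s q = true).map Fin.valEmbedding, ?_, ?_⟩
  · intro q hq
    simp only [mem_map, Fin.valEmbedding_apply] at hq
    obtain ⟨r, -, rfl⟩ := hq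
    exact mem_range.2 r.2
  · funext q
    simp [indStr, Fin.val_inj]

theorem hammingDist_indStr {N : ℕ} {A B : Finset ℕ} (hA : A ⊆ range N) (hB : B ⊆ range N) :
    hammingDist (indStr N A) (indStr N B) + 2 * #(A ∩ B) = #A + #B := by
  have h : hammingDist (indStr N A) (indStr N B) = #(A \ B) + #(B \ A) := by
    rw [← card_union_of_disjoint disjoint_sdiff_sdiff, hammingDist,
      ← card_map Fin.valEmbedding]
    congr 1
    ext q
    have hAq := @hA q
    have hBq := @hB q
    simp only [mem_range] at hAq hBq
    simp only [indStr, mem_map, mem_filter, mem_univ, true_and, Fin.valEmbedding_apply, mem_union,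
      mem_sdiff, ne_eq, decide_eq_decide]
    constructor
    · rintro ⟨r, hr, rfl⟩
      tauto
    · intro hq
      exact ⟨⟨q, by tauto⟩, by tauto, rfl⟩
  have h1 := card_sdiff_add_card_inter A B
  have h2 := card_sdiff_add_card_inter B A
  rw [inter_comm B A] at h2
  omega

section Gadgets

variable {b nh : ℕ} {A P : Finset ℕ}

/-- The positions of the ones of `P ∘ 0^((2^b-2)·nh) ∘ 0 ∘ 1^(nh-1)`. -/
def padSet (b nh : ℕ) (P : Finset ℕ) : Finset ℕ :=
  P ∪ Ioo ((2 ^ b + 1) * nh) ((2 ^ b + 2) * nh)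

/-- The positions of the ones of `P̄ ∘ 0^((2^b-2)·nh) ∘ 1 ∘ 0^(nh-1)`. -/
def padSetC (b nh : ℕ) (P : Finset ℕ) : Finset ℕ :=
  (range (3 * nh) \ P) ∪ {(2 ^ b + 1) * nh}

theorem three_mul_le (hb : 0 < b) : 3 * nh ≤ (2 ^ b + 1) * nh := by
  have : 2 ^ 1 ≤ 2 ^ b := Nat.pow_le_pow_right two_pos hb
  exact Nat.mul_le_mul_right _ (by omega)

theorem length_eq : (2 ^ b + 2) * nh = (2 ^ b + 1) * nh + nh := by ring

theorem grpOne_eq : grpOne b nh = indStr _ (range ((2 ^ b + 1) * nh)) := by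
  funext q
  simp [grpOne, indStr]

theorem zero_eq {N : ℕ} : (fun _ => false : Fin N → Bool) = indStr N ∅ := by
  funext q
  simp [indStr]

theorem vStr_eq (hb : 0 < b) {i : ℕ} (hi : i < nh) :
    vStr b nh i = indStr _ (padSet b nh (Ico (3 * i) (3 * i + 3))) := by
  funext q
  have h3 := three_mul_le (nh := nh) hb
  have hq := q.2
  simp only [vStr, indStr, padSet, mem_union, mem_Ico, mem_Ioo]
  split_ifs <;> simp <;> grind

theorem vStrC_eq (hb : 0 < b) {i : ℕ} :
    vStrC b nh i = indStr _ (padSetC b nh (Ico (3 * i) (3 * i + 3))) := by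
  funext q
  have h3 := three_mul_le (nh := nh) hb
  simp only [vStrC, indStr, padSetC, mem_union, mem_sdiff, mem_Ico, mem_range, mem_singleton,
    ← decide_not]
  split_ifs <;> simp <;> grind

theorem eStr_eq (hb : 0 < b) {n i i' j z : ℕ} (hi : i < nh) (hi' : i' < nh) (hj : n + j < nh)
    (hz : z < 3) :
    eStr b nh n i i' j z
      = indStr _ (padSet b nh {3 * i + z, 3 * i' + z, 3 * (n + j) + z}) := by
  funext q
  have h3 := three_mul_le (nh := nh) hb
  have hq := q.2
  simp only [eStr, indStr, padSet, mem_union, mem_insert, mem_singleton, mem_Ioo]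
  split_ifs <;> simp <;> grind

theorem eStrC_eq (hb : 0 < b) {n i i' j z : ℕ} :
    eStrC b nh n i i' j z
      = indStr _ (padSetC b nh {3 * i + z, 3 * i' + z, 3 * (n + j) + z}) := by
  funext q
  have h3 := three_mul_le (nh := nh) hb
  simp only [eStrC, indStr, padSetC, mem_union, mem_sdiff, mem_insert, mem_range, mem_singleton,
    ← decide_not]
  split_ifs <;> simp <;> grind

theorem padSet_subset (hb : 0 < b) (hP : P ⊆ range (3 * nh)) :
    padSet b nh P ⊆ range ((2 ^ b + 2) * nh) := by
  intro q hq
  have h3 := three_mul_le (nh := nh) hb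
  have hPq := @hP q
  rw [length_eq] at *
  simp only [padSet, mem_union, mem_Ioo, mem_range, length_eq] at *
  grind

theorem padSetC_subset (hb : 0 < b) (hnh : 0 < nh) :
    padSetC b nh P ⊆ range ((2 ^ b + 2) * nh) := by
  intro q hq
  have h3 := three_mul_le (nh := nh) hb
  simp only [padSetC, mem_union, mem_sdiff, mem_singleton, mem_range, length_eq] at *
  grind

theorem card_padSet (hb : 0 < b) (hP : P ⊆ range (3 * nh)) :
    #(padSet b nh P) = #P + (nh - 1) := by
  have h3 := three_mul_le (nh := nh) hb
  rw [padSet, card_union_of_disjoint, Nat.card_Ioo, length_eq]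
  · congr 1
    omega
  · rw [disjoint_left]
    intro q hq hq'
    have := mem_range.1 (hP hq)
    have := mem_Ioo.1 hq'
    omega

theorem card_padSetC (hb : 0 < b) (hP : P ⊆ range (3 * nh)) :
    #(padSetC b nh P) + #P = 3 * nh + 1 := by
  have h3 := three_mul_le (nh := nh) hb
  have h := card_sdiff_add_card_eq_card hP
  rw [card_range] at h
  rw [padSetC, card_union_of_disjoint, card_singleton]
  · omega
  · rw [disjoint_singleton_right]
    simp
    omega

theorem disjoint_padSet_padSetC (hb : 0 < b) (hP : P ⊆ range (3 * nh)) :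
    Disjoint (padSet b nh P) (padSetC b nh P) := by
  have h3 := three_mul_le (nh := nh) hb
  rw [disjoint_left]
  intro q hq hq'
  have hPq := @hP q
  simp only [padSet, padSetC, mem_union, mem_Ioo, mem_sdiff, mem_singleton, mem_range] at *
  grind

theorem le_hammingDist_add_hammingDist (hb : 0 < b) (hnh : 0 < nh) (hP : P ⊆ range (3 * nh))
    (hA : A ⊆ range ((2 ^ b + 2) * nh)) :
    4 * nh ≤ hammingDist (indStr ((2 ^ b + 2) * nh) A) (indStr _ (padSet b nh P))
      + hammingDist (indStr ((2 ^ b + 2) * nh) A) (indStr _ (padSetC b nh P)) := by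
  have h1 := hammingDist_indStr hA (padSet_subset hb hP)
  have h2 := hammingDist_indStr hA (padSetC_subset (P := P) hb hnh)
  have h3 := card_padSet hb hP
  have h4 := card_padSetC hb hP
  have h5 : #(A ∩ padSet b nh P) + #(A ∩ padSetC b nh P) ≤ #A := by
    rw [← card_union_of_disjoint
      ((disjoint_padSet_padSetC hb hP).mono inter_subset_right inter_subset_right),
      ← inter_union_distrib_left]
    exact card_le_card inter_subset_left
  omega

theorem inter_padSet (hA : A ⊆ range ((2 ^ b + 1) * nh)) : A ∩ padSet b nh P = A ∩ P := by
  rw [padSet, inter_union_distrib_left, union_eq_left]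
  intro q hq
  simp only [mem_inter, mem_Ioo] at hq
  have := mem_range.1 (hA hq.1)
  omega

theorem range_subset_length : range ((2 ^ b + 1) * nh) ⊆ range ((2 ^ b + 2) * nh) :=
  range_subset_range.2 (Nat.mul_le_mul_right _ (by omega))

theorem hammingDist_padSet_eq_iff (hb : 0 < b) (hnh : 0 < nh) (hP : P ⊆ range (3 * nh))
    (hPc : #P = 3) (hA : A ⊆ range ((2 ^ b + 1) * nh)) (hAc : #A = nh) :
    hammingDist (indStr ((2 ^ b + 2) * nh) A) (indStr _ (padSet b nh P)) = 2 * nh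
      ↔ #(A ∩ P) = 1 := by
  have h1 := hammingDist_indStr (hA.trans range_subset_length) (padSet_subset hb hP)
  have h3 := card_padSet hb hP
  rw [inter_padSet hA] at h1
  omega

theorem hammingDist_padSetC_eq (hb : 0 < b) (hnh : 0 < nh) (hP : P ⊆ range (3 * nh))
    (hPc : #P = 3) (hA : A ⊆ range (3 * nh)) (hAc : #A = nh) (hAP : #(A ∩ P) = 1) :
    hammingDist (indStr ((2 ^ b + 2) * nh) A) (indStr _ (padSetC b nh P)) = 2 * nh := by
  have hA' := hA.trans (range_subset_range.2 (three_mul_le hb))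
  have h2 := hammingDist_indStr (hA'.trans range_subset_length) (padSetC_subset (P := P) hb hnh)
  have h4 := card_padSetC hb hP
  have h5 : A ∩ padSetC b nh P = A \ P := by
    ext q
    have hAq := @hA q
    have h3 := three_mul_le (nh := nh) hb
    simp only [padSetC, mem_inter, mem_union, mem_sdiff, mem_singleton, mem_range] at *
    grind
  have h6 := card_sdiff_add_card_inter A P
  rw [h5] at h2
  omega

theorem hammingDist_grpOne (hA : A ⊆ range ((2 ^ b + 2) * nh)) :
    hammingDist (indStr ((2 ^ b + 2) * nh) A) (grpOne b nh)
      + 2 * #(A ∩ range ((2 ^ b + 1) * nh)) = #A + (2 ^ b * nh + nh) := by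
  rw [grpOne_eq, hammingDist_indStr hA range_subset_length, card_range, add_one_mul]

theorem hammingDist_zero {N : ℕ} (hA : A ⊆ range N) :
    hammingDist (indStr N A) (fun _ => false) = #A := by
  rw [zero_eq]
  simpa using hammingDist_indStr hA (empty_subset _)

end Gadgets

section Coloring

variable {n m : ℕ}

/-- The positions of the ones of the edge pattern of the edge `e` with index `j` and color `z`. -/
def edgeSet (n : ℕ) (e : Fin n × Fin n) (j z : ℕ) : Finset ℕ :=
  {3 * (e.1 : ℕ) + z, 3 * (e.2 : ℕ) + z, 3 * (n + j) + z}

theorem edgeSet_subset (e : Fin n × Fin n) (j : Fin m) (z : Fin 3) :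
    edgeSet n e j z ⊆ range (3 * (n + m)) := by
  intro q
  simp only [edgeSet, mem_insert, mem_singleton, mem_range]
  omega

theorem card_edgeSet (e : Fin n × Fin n) (he : e.1 < e.2) (j z : ℕ) : #(edgeSet n e j z) = 3 := by
  have : (e.1 : ℕ) < e.2 := he
  rw [edgeSet, card_eq_three]
  exact ⟨_, _, _, by omega, by omega, by omega, rfl⟩

theorem Ico_subset_range (i : Fin n) : Ico (3 * (i : ℕ)) (3 * i + 3) ⊆ range (3 * (n + m)) := by
  intro q
  simp only [mem_Ico, mem_range]
  omega

/-- A set meeting every vertex block and every edge pattern exactly once is a proper 3-coloring. -/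
theorem exists_coloring_of_card_inter {E : Fin m → Fin n × Fin n} (hE : ∀ j, (E j).1 < (E j).2)
    {A : Finset ℕ} (hV : ∀ i : Fin n, #(A ∩ Ico (3 * (i : ℕ)) (3 * i + 3)) = 1)
    (hW : ∀ (j : Fin m) (z : Fin 3), #(A ∩ edgeSet n (E j) j z) = 1) :
    ∃ col : Fin n → Fin 3, ∀ j, col (E j).1 ≠ col (E j).2 := by
  have hcol : ∀ i : Fin n, ∃ z : Fin 3, 3 * (i : ℕ) + z ∈ A := by
    intro i
    obtain ⟨q, hq⟩ := card_pos.1 (by rw [hV i]; exact one_pos)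
    simp only [mem_inter, mem_Ico] at hq
    refine ⟨⟨q - 3 * i, by omega⟩, ?_⟩
    rw [show 3 * (i : ℕ) + (q - 3 * i) = q by omega]
    exact hq.1
  choose col hcol using hcol
  refine ⟨col, fun j hj => ?_⟩
  have h1 := hcol (E j).1
  have h2 := hcol (E j).2
  rw [← hj] at h2
  have hlt : ((E j).1 : ℕ) < (E j).2 := hE j
  have := card_le_one.1 (hW j (col (E j).1)).le _ (mem_inter.2 ⟨h1, by simp [edgeSet]⟩) _
    (mem_inter.2 ⟨h2, by simp [edgeSet]⟩)
  omega

theorem exists_third_color : ∀ x y : Fin 3, x ≠ y → ∃ w : Fin 3, ∀ z : Fin 3,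
    (z = x ∧ z ≠ y ∧ z ≠ w) ∨ (z ≠ x ∧ z = y ∧ z ≠ w) ∨ (z ≠ x ∧ z ≠ y ∧ z = w) := by
  decide

/-- A proper 3-coloring, together with the unused color of every edge, is a set meeting every
vertex block and every edge pattern exactly once. -/
theorem exists_card_inter_of_coloring {E : Fin m → Fin n × Fin n}
    {col : Fin n → Fin 3} (hcol : ∀ j, col (E j).1 ≠ col (E j).2) :
    ∃ A ⊆ range (3 * (n + m)), #A = n + m ∧
      (∀ i : Fin n, #(A ∩ Ico (3 * (i : ℕ)) (3 * i + 3)) = 1) ∧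
      ∀ (j : Fin m) (z : Fin 3), #(A ∩ edgeSet n (E j) j z) = 1 := by
  choose w hw using fun j => exists_third_color _ _ (hcol j)
  let c : Fin (n + m) → Fin 3 := Fin.append col w
  let f : Fin (n + m) → ℕ := fun k => 3 * (k : ℕ) + c k
  have hf : Function.Injective f := by
    intro k l hkl
    simp only [f] at hkl
    exact Fin.ext (by omega)
  have hmem : ∀ (k : Fin (n + m)) (z : ℕ), z < 3 →
      (3 * (k : ℕ) + z ∈ univ.image f ↔ z = c k) := by
    intro k z hz
    simp only [mem_image, mem_univ, true_and, f]
    constructor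
    · rintro ⟨l, hl⟩
      obtain rfl : l = k := Fin.ext (by omega)
      omega
    · rintro rfl
      exact ⟨k, rfl⟩
  have hmemV : ∀ (i : Fin n) (z : ℕ), z < 3 →
      (3 * (i : ℕ) + z ∈ univ.image f ↔ z = col i) := by
    intro i z hz
    simpa [c] using hmem (Fin.castAdd m i) z hz
  have hmemE : ∀ (j : Fin m) (z : ℕ), z < 3 →
      (3 * (n + (j : ℕ)) + z ∈ univ.image f ↔ z = w j) := by
    intro j z hz
    simpa [c] using hmem (Fin.natAdd n j) z hz
  refine ⟨univ.image f, ?_, ?_, ?_, ?_⟩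
  · intro q hq
    obtain ⟨k, -, rfl⟩ := mem_image.1 hq
    simp only [f, mem_range]
    omega
  · rw [card_image_of_injective _ hf, card_univ, Fintype.card_fin]
  · intro i
    rw [card_eq_one]
    refine ⟨3 * (i : ℕ) + col i, ?_⟩
    ext q
    simp only [mem_inter, mem_Ico, mem_singleton]
    constructor
    · rintro ⟨hq, h1, h2⟩
      have := (hmemV i (q - 3 * i) (by omega)).1
        (by rwa [show 3 * (i : ℕ) + (q - 3 * i) = q by omega])
      omega
    · rintro rfl
      exact ⟨(hmemV i _ (col i).2).2 rfl, by omega, by omega⟩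
  · intro j z
    have h1 := hmemV (E j).1 z z.2
    have h2 := hmemV (E j).2 z z.2
    have h3 := hmemE j z z.2
    rw [Fin.val_inj] at h1 h2 h3
    rw [card_eq_one]
    rcases hw j z with h | h | h
    · refine ⟨3 * ((E j).1 : ℕ) + z, ?_⟩
      ext q
      simp only [edgeSet, mem_inter, mem_insert, mem_singleton]
      grind
    · refine ⟨3 * ((E j).2 : ℕ) + z, ?_⟩
      ext q
      simp only [edgeSet, mem_inter, mem_insert, mem_singleton]
      grind
    · refine ⟨3 * (n + (j : ℕ)) + z, ?_⟩
      ext q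
      simp only [edgeSet, mem_inter, mem_insert, mem_singleton]
      grind

end Coloring

theorem two_pow_rpow_div {a b : ℕ} (hb : 0 < b) : ((2 : ℝ) ^ b) ^ ((a : ℝ) / b) = 2 ^ a := by
  rw [← Real.rpow_natCast, ← Real.rpow_mul zero_le_two, mul_div_cancel₀ _ (by positivity),
    Real.rpow_natCast]

theorem rpow_mul_two_pow {a b : ℕ} (hb : 0 < b) {x : ℝ} (hx : 0 ≤ x) :
    (2 ^ b * x) ^ ((a : ℝ) / b) = 2 ^ a * x ^ ((a : ℝ) / b) := by
  rw [Real.mul_rpow (by positivity) hx, two_pow_rpow_div hb]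

theorem rpow_sub_one_mul_two_pow {a b : ℕ} (hb : 0 < b) (hab : b < a) {x : ℝ} (hx : 0 ≤ x) :
    (2 ^ b * x) ^ ((a : ℝ) / b - 1) = 2 ^ (a - b) * x ^ ((a : ℝ) / b - 1) := by
  have h : (a : ℝ) / b - 1 = ((a - b : ℕ) : ℝ) / b := by
    rw [Nat.cast_sub hab.le, sub_div, div_self (by positivity)]
  rw [h, rpow_mul_two_pow hb hx]

theorem stmt_7 (a b : ℕ) (hb : 0 < b) (hab : b < a) (hcop : Nat.Coprime a b)
    (n m : ℕ) (E : Fin m → Fin n × Fin n)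
    (hE1 : ∀ j, (E j).1 < (E j).2) (hE2 : Function.Injective E) :
    (∃ col : Fin n → Fin 3, ∀ j, col (E j).1 ≠ col (E j).2) ↔
      ∃ sstar : Fin ((2 ^ b + 2) * (n + m)) → Bool,
        (hammingDist sstar (grpOne b (n + m)) : ℝ) ^ ((a : ℝ) / b)
          + 2 ^ (a - b) * (hammingDist sstar (fun _ => false) : ℝ) ^ ((a : ℝ) / b)
          + (∑ i : Fin n,
              ((hammingDist sstar (vStr b (n + m) i) : ℝ) ^ ((a : ℝ) / b)
                + (hammingDist sstar (vStrC b (n + m) i) : ℝ) ^ ((a : ℝ) / b)))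
          + (∑ j : Fin m, ∑ z : Fin 3,
              ((hammingDist sstar (eStr b (n + m) n (E j).1 (E j).2 j z) : ℝ) ^ ((a : ℝ) / b)
                + (hammingDist sstar
                    (eStrC b (n + m) n (E j).1 (E j).2 j z) : ℝ) ^ ((a : ℝ) / b)))
          ≤ (2 ^ a + 2 ^ (a - b)) * ((n + m : ℕ) : ℝ) ^ ((a : ℝ) / b)
            + 2 * ((n : ℝ) + 3 * (m : ℝ)) * (2 * ((n + m : ℕ) : ℝ)) ^ ((a : ℝ) / b) := by
  rcases Nat.eq_zero_or_pos (n + m) with h0 | hnh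
  · obtain ⟨rfl, rfl⟩ : n = 0 ∧ m = 0 := by omega
    have ha : 0 < a := hb.trans hab
    have hp0 : (a : ℝ) / b ≠ 0 := by positivity
    refine ⟨fun _ => ⟨fun _ => false, ?_⟩, fun _ => ⟨fun i => i.elim0, fun j => j.elim0⟩⟩
    have h (s t : Fin ((2 ^ b + 2) * (0 + 0)) → Bool) : hammingDist s t = 0 := by
      rw [hammingDist_eq_zero]
      funext q
      exact absurd q.2 (by simp)
    simp [h, Real.zero_rpow hp0]
  have hp : 1 < (a : ℝ) / b := by
    rw [one_lt_div (by positivity)]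
    exact_mod_cast hab
  have hx : (0 : ℝ) < ((n + m : ℕ) : ℝ) := by exact_mod_cast hnh
  have hw : (0 : ℝ) < 2 ^ (a - b) := by positivity
  have hslope := rpow_sub_one_mul_two_pow hb hab hx.le
  have hv (i : Fin n) : vStr b (n + m) i = indStr _ (padSet b _ (Ico (3 * i) (3 * i + 3))) :=
    vStr_eq hb (by omega)
  have hvC (i : Fin n) : vStrC b (n + m) i = indStr _ (padSetC b _ (Ico (3 * i) (3 * i + 3))) :=
    vStrC_eq hb
  have he (j : Fin m) (z : Fin 3) : eStr b (n + m) n (E j).1 (E j).2 j z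
      = indStr _ (padSet b _ (edgeSet n (E j) j z)) :=
    eStr_eq hb (by omega) (by omega) (by omega) z.2
  have heC (j : Fin m) (z : Fin 3) : eStrC b (n + m) n (E j).1 (E j).2 j z
      = indStr _ (padSetC b _ (edgeSet n (E j) j z)) :=
    eStrC_eq hb
  simp only [hv, hvC, he, heC]
  have hIco (i : Fin n) : #(Ico (3 * (i : ℕ)) (3 * i + 3)) = 3 := by simp
  have hbound : (2 ^ a + 2 ^ (a - b)) * ((n + m : ℕ) : ℝ) ^ ((a : ℝ) / b)
      + 2 * ((n : ℝ) + 3 * (m : ℝ)) * (2 * ((n + m : ℕ) : ℝ)) ^ ((a : ℝ) / b)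
      = ((2 ^ b * ((n + m : ℕ) : ℝ)) ^ ((a : ℝ) / b)
          + 2 ^ (a - b) * ((n + m : ℕ) : ℝ) ^ ((a : ℝ) / b))
        + (∑ _i : Fin n, ((2 * ((n + m : ℕ) : ℝ)) ^ ((a : ℝ) / b)
            + (2 * ((n + m : ℕ) : ℝ)) ^ ((a : ℝ) / b)))
        + ∑ _j : Fin m, ∑ _z : Fin 3, ((2 * ((n + m : ℕ) : ℝ)) ^ ((a : ℝ) / b)
            + (2 * ((n + m : ℕ) : ℝ)) ^ ((a : ℝ) / b)) := by
    simp only [sum_const, card_univ, Fintype.card_fin, nsmul_eq_mul, rpow_mul_two_pow hb hx.le]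
    push_cast
    ring
  rw [hbound]
  constructor
  · rintro ⟨col, hcol⟩
    obtain ⟨A, hA, hAc, hV, hW⟩ := exists_card_inter_of_coloring hcol
    have hA' := hA.trans (range_subset_range.2 (three_mul_le hb))
    have hA'' := hA'.trans range_subset_length
    refine ⟨indStr _ A, le_of_eq ?_⟩
    have hone : hammingDist (indStr _ A) (grpOne b (n + m)) = 2 ^ b * (n + m) := by
      have h := hammingDist_grpOne hA''
      rw [inter_eq_left.2 hA', hAc] at h
      omega
    simp only [hone, hammingDist_zero hA'', hAc,
      (hammingDist_padSet_eq_iff hb hnh (Ico_subset_range _) (hIco _) hA' hAc).2 (hV _),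
      hammingDist_padSetC_eq hb hnh (Ico_subset_range _) (hIco _) hA hAc (hV _),
      (hammingDist_padSet_eq_iff hb hnh (edgeSet_subset _ _ _) (card_edgeSet _ (hE1 _) _ _)
        hA' hAc).2 (hW _ _),
      hammingDist_padSetC_eq hb hnh (edgeSet_subset _ _ _) (card_edgeSet _ (hE1 _) _ _) hA hAc
        (hW _ _)]
    push_cast
    rfl
  · rintro ⟨s, hs⟩
    obtain ⟨A, hA, rfl⟩ := exists_eq_indStr s
    have hone := hammingDist_grpOne hA
    have hzero := hammingDist_zero hA
    have hAle : #(A ∩ range ((2 ^ b + 1) * (n + m))) ≤ #A := card_le_card inter_subset_left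
    have hsum : (2 ^ b * ((n + m : ℕ) : ℝ)) + ((n + m : ℕ) : ℝ)
        ≤ hammingDist (indStr _ A) (grpOne b (n + m))
          + hammingDist (indStr ((2 ^ b + 2) * (n + m)) A) (fun _ => false) := by
      have : 2 ^ b * (n + m) + (n + m) ≤ hammingDist (indStr _ A) (grpOne b (n + m))
          + hammingDist (indStr ((2 ^ b + 2) * (n + m)) A) (fun _ => false) := by omega
      exact_mod_cast this
    have hG := rpow_add_mul_rpow_ge hp hw (by positivity) hx hslope (Nat.cast_nonneg _)
      (Nat.cast_nonneg _) hsum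
    have hpair {P : Finset ℕ} (hP : P ⊆ range (3 * (n + m))) :
        2 * ((n + m : ℕ) : ℝ) + 2 * ((n + m : ℕ) : ℝ)
        ≤ hammingDist (indStr ((2 ^ b + 2) * (n + m)) A) (indStr _ (padSet b (n + m) P))
          + hammingDist (indStr ((2 ^ b + 2) * (n + m)) A) (indStr _ (padSetC b (n + m) P)) := by
      have := le_hammingDist_add_hammingDist hb hnh hP hA
      rw [← two_mul, ← mul_assoc]
      norm_num1
      exact_mod_cast this
    have hge {P : Finset ℕ} (hP : P ⊆ range (3 * (n + m))) :
        (2 * ((n + m : ℕ) : ℝ)) ^ ((a : ℝ) / b) + (2 * ((n + m : ℕ) : ℝ)) ^ ((a : ℝ) / b)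
        ≤ (hammingDist (indStr ((2 ^ b + 2) * (n + m)) A) (indStr _ (padSet b (n + m) P)) : ℝ)
            ^ ((a : ℝ) / b)
          + (hammingDist (indStr ((2 ^ b + 2) * (n + m)) A) (indStr _ (padSetC b (n + m) P)) : ℝ)
            ^ ((a : ℝ) / b) := by
      simpa only [one_mul] using rpow_add_mul_rpow_ge hp one_pos (by positivity) (by positivity)
        (one_mul _).symm (Nat.cast_nonneg _) (Nat.cast_nonneg _) (hpair hP)
    have heq {P : Finset ℕ} (hP : P ⊆ range (3 * (n + m)))
        (h : (2 * ((n + m : ℕ) : ℝ)) ^ ((a : ℝ) / b) + (2 * ((n + m : ℕ) : ℝ)) ^ ((a : ℝ) / b)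
        = (hammingDist (indStr ((2 ^ b + 2) * (n + m)) A) (indStr _ (padSet b (n + m) P)) : ℝ)
            ^ ((a : ℝ) / b)
          + (hammingDist (indStr ((2 ^ b + 2) * (n + m)) A) (indStr _ (padSetC b (n + m) P)) : ℝ)
            ^ ((a : ℝ) / b)) :
        hammingDist (indStr ((2 ^ b + 2) * (n + m)) A) (indStr _ (padSet b (n + m) P))
          = 2 * (n + m) := by
      have := (eq_and_eq_of_rpow_add_mul_rpow_le hp one_pos (by positivity) (by positivity)
        (one_mul _).symm (Nat.cast_nonneg _) (Nat.cast_nonneg _) (hpair hP)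
        (by simpa only [one_mul] using h.ge)).1
      exact_mod_cast this
    have hVle := fun i (_ : i ∈ (univ : Finset (Fin n))) => hge (Ico_subset_range (m := m) i)
    have hWle := fun j (_ : j ∈ (univ : Finset (Fin m))) =>
      fun z (_ : z ∈ (univ : Finset (Fin 3))) => hge (edgeSet_subset (E j) j z)
    have hWle' := fun j hj => sum_le_sum (hWle j hj)
    have hVsum := sum_le_sum hVle
    have hWsum := sum_le_sum hWle'
    have hVeq := (sum_eq_sum_iff_of_le hVle).1 (by linarith)
    have hWeq' := (sum_eq_sum_iff_of_le hWle').1 (by linarith)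
    have hWeq := fun j hj => (sum_eq_sum_iff_of_le (hWle j hj)).1 (hWeq' j hj)
    obtain ⟨hu, hv⟩ := eq_and_eq_of_rpow_add_mul_rpow_le hp hw (by positivity) hx hslope
      (Nat.cast_nonneg _) (Nat.cast_nonneg _) hsum (by linarith)
    have hu' : hammingDist (indStr _ A) (grpOne b (n + m)) = 2 ^ b * (n + m) := by
      exact_mod_cast hu
    have hAc : #A = n + m := by
      rw [← hzero]
      exact_mod_cast hv
    have hA' : A ⊆ range ((2 ^ b + 1) * (n + m)) := by
      rw [← inter_eq_left]
      refine eq_of_subset_of_card_le inter_subset_left ?_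
      rw [hu'] at hone
      omega
    refine exists_coloring_of_card_inter (A := A) hE1 (fun i => ?_) (fun j z => ?_)
    · exact (hammingDist_padSet_eq_iff hb hnh (Ico_subset_range _) (hIco _) hA' hAc).1
        (heq (Ico_subset_range i) (hVeq i (mem_univ _)))
    · exact (hammingDist_padSet_eq_iff hb hnh (edgeSet_subset _ _ _)
        (card_edgeSet _ (hE1 _) _ _) hA' hAc).1
        (heq (edgeSet_subset (E j) j z) (hWeq j (mem_univ _) z (mem_univ _)))
end
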